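/- Let N ≥ 3, p > 1 and σ ≤ (N−(N−2)p)/2. Then there is no twice continuously differentiable function u : ℝ^N → ℝ with u(x) > 0 for all x and −Δu(x) + σ·‖∇u(x)‖²/u(x) ≥ u(x)^p for every x ∈ ℝ^N. -/

import Mathlib

open MeasureTheory Filter Set

/-- The Euclidean Laplacian: the sum of the second partial derivatives. -/
noncomputable def lap {N : ℕ} (u : EuclideanSpace ℝ (Fin N) → ℝ)
    (x : EuclideanSpace ℝ (Fin N)) : ℝ :=
  ∑ i : Fin N,
    fderiv ℝ (fun y => fderiv ℝ u y (EuclideanSpace.single i 1)) x (EuclideanSpace.single i 1)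

section

variable {N : ℕ}

/-- The chain rule for the Laplacian of `f ∘ u`. -/
theorem lap_comp {u : EuclideanSpace ℝ (Fin N) → ℝ} (hu : ContDiff ℝ 2 u) {f f' : ℝ → ℝ}
    {f'' : ℝ} {x : EuclideanSpace ℝ (Fin N)} (hf : ∀ y, HasDerivAt f (f' (u y)) (u y))
    (hf' : HasDerivAt f' f'' (u x)) :
    lap (fun y => f (u y)) x = f' (u x) * lap u x + f'' * ‖gradient u x‖ ^ 2 := by
  have hd : ∀ y, HasFDerivAt u (fderiv ℝ u y) y := fun y =>
    (hu.differentiable (by norm_num) y).hasFDerivAt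
  have hd2 : Differentiable ℝ (fderiv ℝ u) :=
    (hu.fderiv_right (m := 1) (by norm_num)).differentiable (by norm_num)
  have key : ∀ e : EuclideanSpace ℝ (Fin N),
      fderiv ℝ (fun y => fderiv ℝ (fun y => f (u y)) y e) x e
        = f' (u x) * fderiv ℝ (fun y => fderiv ℝ u y e) x e + f'' * (fderiv ℝ u x e) ^ 2 := by
    intro e
    have h1 : (fun y => fderiv ℝ (fun y => f (u y)) y e) = fun y => f' (u y) * fderiv ℝ u y e := by
      funext y
      have := (hf y).comp_hasFDerivAt y (hd y)
      rw [show (fun y => f (u y)) = f ∘ u from rfl, this.fderiv]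
      simp
    have h2 : HasFDerivAt (fun y => f' (u y)) (f'' • fderiv ℝ u x) x :=
      hf'.comp_hasFDerivAt x (hd x)
    have h3 : DifferentiableAt ℝ (fun y => fderiv ℝ u y e) x :=
      (hd2 x).clm_apply (differentiableAt_const e)
    rw [h1, (h2.fun_mul h3.hasFDerivAt).fderiv]
    simp
    ring
  have hg : ‖gradient u x‖ ^ 2 = ∑ i : Fin N, (fderiv ℝ u x (EuclideanSpace.single i 1)) ^ 2 := by
    rw [EuclideanSpace.norm_sq_eq]
    refine Finset.sum_congr rfl fun i _ => ?_
    rw [← inner_gradient_left, EuclideanSpace.inner_single_right]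
    simp
  simp only [lap, key, hg, Finset.sum_add_distrib, Finset.mul_sum]

theorem lap_comp_smul (g : EuclideanSpace ℝ (Fin N) → ℝ) (r : ℝ)
    (x : EuclideanSpace ℝ (Fin N)) :
    lap (fun y => g (r • y)) x = r ^ 2 * lap g (r • x) := by
  simp only [lap, Finset.mul_sum]
  refine Finset.sum_congr rfl fun i _ => ?_
  set e : EuclideanSpace ℝ (Fin N) := EuclideanSpace.single i 1
  have h1 : (fun y => fderiv ℝ (fun y => g (r • y)) y e)
      = r • fun y => (fun z => fderiv ℝ g z e) (r • y) := by
    funext y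
    rw [fderiv_comp_smul]
    simp
  rw [h1, fderiv_const_smul_field, Pi.smul_apply, fderiv_comp_smul (f := fun z => fderiv ℝ g z e)]
  simp
  ring

theorem lap_eq_zero_of_eventuallyEq_const {g : EuclideanSpace ℝ (Fin N) → ℝ} {c : ℝ}
    {x : EuclideanSpace ℝ (Fin N)} (h : g =ᶠ[nhds x] fun _ => c) : lap g x = 0 := by
  refine Finset.sum_eq_zero fun i _ => ?_
  have h1 : (fun y => fderiv ℝ g y (EuclideanSpace.single i 1)) =ᶠ[nhds x] fun _ => 0 := by
    filter_upwards [h.eventuallyEq_nhds] with y hy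
    rw [hy.fderiv_eq]
    simp
  rw [h1.fderiv_eq]
  simp

theorem ContDiff.fderiv_apply_const {u : EuclideanSpace ℝ (Fin N) → ℝ} {m n : WithTop ℕ∞}
    (hu : ContDiff ℝ n u) (hmn : m + 1 ≤ n) (e : EuclideanSpace ℝ (Fin N)) :
    ContDiff ℝ m (fun y => fderiv ℝ u y e) :=
  (hu.fderiv_right hmn).clm_apply contDiff_const

theorem continuous_lap {u : EuclideanSpace ℝ (Fin N) → ℝ} (hu : ContDiff ℝ 2 u) :
    Continuous (lap u) :=
  continuous_finsetSum _ fun _ _ =>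
    ((hu.fderiv_apply_const (m := 1) (by norm_num) _).fderiv_apply_const (m := 0)
      (by norm_num) _).continuous

theorem HasCompactSupport.lap {φ : EuclideanSpace ℝ (Fin N) → ℝ} (hφ : HasCompactSupport φ) :
    HasCompactSupport (lap φ) := by
  refine hφ.mono' fun x hx => ?_
  by_contra h
  exact hx (lap_eq_zero_of_eventuallyEq_const (notMem_tsupport_iff_eventuallyEq.1 h))

/-- Green's second identity on the whole space, for a compactly supported test function. -/
theorem integral_mul_lap_eq {v φ : EuclideanSpace ℝ (Fin N) → ℝ} (hv : ContDiff ℝ 2 v)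
    (hφ : ContDiff ℝ 2 φ) (hc : HasCompactSupport φ) :
    ∫ x, v x * lap φ x = ∫ x, lap v x * φ x := by
  have hv1 := fun e => hv.fderiv_apply_const (m := 1) (by norm_num) e
  have hφ1 := fun e => hφ.fderiv_apply_const (m := 1) (by norm_num) e
  have hv2 := fun e => (hv1 e).fderiv_apply_const (m := 0) (by norm_num) e
  have hφ2 := fun e => (hφ1 e).fderiv_apply_const (m := 0) (by norm_num) e
  have hc1 := fun e => hc.fderiv_apply (𝕜 := ℝ) e
  have hc2 := fun e => (hc1 e).fderiv_apply (𝕜 := ℝ) e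
  have i1 : ∀ e, Integrable fun x => v x * fderiv ℝ (fun y => fderiv ℝ φ y e) x e := fun e =>
    (hv.continuous.mul (hφ2 e).continuous).integrable_of_hasCompactSupport (hc2 e).mul_left
  have i2 : ∀ e, Integrable fun x => fderiv ℝ (fun y => fderiv ℝ v y e) x e * φ x := fun e =>
    ((hv2 e).continuous.mul hφ.continuous).integrable_of_hasCompactSupport hc.mul_left
  have i3 : ∀ e, Integrable fun x => fderiv ℝ v x e * fderiv ℝ φ x e := fun e =>
    ((hv1 e).continuous.mul (hφ1 e).continuous).integrable_of_hasCompactSupport (hc1 e).mul_left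
  have i4 : ∀ e, Integrable fun x => v x * fderiv ℝ φ x e := fun e =>
    (hv.continuous.mul (hφ1 e).continuous).integrable_of_hasCompactSupport (hc1 e).mul_left
  have i5 : ∀ e, Integrable fun x => fderiv ℝ v x e * φ x := fun e =>
    ((hv1 e).continuous.mul hφ.continuous).integrable_of_hasCompactSupport hc.mul_left
  have dv := hv.differentiable (by norm_num)
  have dφ := hφ.differentiable (by norm_num)
  have dv1 := fun e => (hv1 e).differentiable (by norm_num)
  have dφ1 := fun e => (hφ1 e).differentiable (by norm_num)
  simp only [lap, Finset.mul_sum, Finset.sum_mul]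
  rw [integral_finsetSum _ fun i _ => i1 _, integral_finsetSum _ fun i _ => i2 _]
  refine Finset.sum_congr rfl fun i _ => ?_
  rw [integral_mul_fderiv_eq_neg_fderiv_mul_of_integrable (i3 _) (i1 _) (i4 _)
      (fun x _ => dv x) (fun x _ => dφ1 _ x),
    integral_mul_fderiv_eq_neg_fderiv_mul_of_integrable (i2 _) (i3 _) (i5 _)
      (fun x _ => dv1 _ x) (fun x _ => dφ x), neg_neg]

end

/-- Cutoff functions `η` at scale `R` for which the Laplacian of `η ^ (n + 2)` is controlled by
`R⁻² * η ^ n`, with a constant that does not depend on `R`. -/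
theorem exists_cutoff (N n : ℕ) : ∃ A : ℝ, 0 < A ∧ ∀ R : ℝ, 0 < R →
    ∃ η : EuclideanSpace ℝ (Fin N) → ℝ, ContDiff ℝ 2 η ∧ HasCompactSupport η ∧
      (∀ x, 0 ≤ η x) ∧ (∀ x, η x ≤ 1) ∧ (∀ x ∈ Metric.ball 0 R, η x = 1) ∧
      (∀ x ∉ Metric.ball 0 (2 * R), η x = 0) ∧
      (∀ x ∈ Metric.ball 0 R, lap (fun y => η y ^ (n + 2)) x = 0) ∧
      ∀ x, |lap (fun y => η y ^ (n + 2)) x| ≤ A * (R⁻¹ ^ 2 * η x ^ n) := by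
  let b : ContDiffBump (0 : EuclideanSpace ℝ (Fin N)) := ⟨1, 2, one_pos, one_lt_two⟩
  have hb : ContDiff ℝ 2 b := b.contDiff
  have hbc : HasCompactSupport b := b.hasCompactSupport
  let G : EuclideanSpace ℝ (Fin N) → ℝ := fun x =>
    (n + 2) * (b x * lap b x) + (n + 2) * (n + 1) * ‖gradient b x‖ ^ 2
  have hG : ∀ x, lap (fun y => b y ^ (n + 2)) x = b x ^ n * G x := by
    intro x
    rw [lap_comp hb (f := fun t => t ^ (n + 2)) (f' := fun t => (n + 2) * t ^ (n + 1))
      (f'' := (n + 2) * ((n + 1) * b x ^ n))]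
    · simp only [G]
      ring
    · intro y
      simpa using hasDerivAt_pow (n + 2) (b y)
    · simpa using (hasDerivAt_pow (n + 1) (b x)).const_mul ((n : ℝ) + 2)
  have hgc : Continuous (gradient b) :=
    (InnerProductSpace.toDual ℝ _).symm.continuous.comp (hb.continuous_fderiv (by norm_num))
  have hGc : Continuous G := by
    have := continuous_lap hb
    have := hb.continuous
    fun_prop
  have hgs : HasCompactSupport (gradient b) :=
    (hbc.fderiv (𝕜 := ℝ)).comp_left (g := (InnerProductSpace.toDual ℝ _).symm) (map_zero _)
  have hGs : HasCompactSupport G := by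
    refine HasCompactSupport.add (f := fun x => (n + 2) * (b x * lap b x)) ?_ ?_
    · exact (hbc.mul_right (f' := lap b)).mul_left (f := fun _ => (n : ℝ) + 2)
    · exact (hgs.comp_left (g := fun w => ‖w‖ ^ 2) (by simp)).mul_left
        (f := fun _ => ((n : ℝ) + 2) * (n + 1))
  obtain ⟨C, hC⟩ := hGc.bounded_above_of_compact_support hGs
  refine ⟨|C| + 1, by positivity, fun R hR => ⟨fun x => b (R⁻¹ • x), ?_, ?_, fun x => b.nonneg,
    fun x => b.le_one, ?_, ?_, ?_, ?_⟩⟩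
  · exact hb.comp (contDiff_const_smul _)
  · exact hbc.comp_smul (inv_ne_zero hR.ne')
  · intro x hx
    apply b.one_of_mem_closedBall
    rw [mem_ball_zero_iff] at hx
    rw [mem_closedBall_zero_iff, norm_smul, norm_inv, Real.norm_of_nonneg hR.le, inv_mul_le_iff₀ hR]
    change _ ≤ R * 1
    linarith
  · intro x hx
    apply b.zero_of_le_dist
    rw [mem_ball_zero_iff, not_lt] at hx
    rw [dist_zero_right, norm_smul, norm_inv, Real.norm_of_nonneg hR.le, le_inv_mul_iff₀ hR]
    change R * 2 ≤ _
    linarith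
  · intro x hx
    rw [lap_comp_smul (fun y => b y ^ (n + 2))]
    rw [lap_eq_zero_of_eventuallyEq_const (c := 1), mul_zero]
    have : R⁻¹ • x ∈ Metric.ball (0 : EuclideanSpace ℝ (Fin N)) b.rIn := by
      rw [mem_ball_zero_iff] at hx
      rw [mem_ball_zero_iff, norm_smul, norm_inv, Real.norm_of_nonneg hR.le, inv_mul_lt_iff₀ hR]
      change _ < R * 1
      linarith
    filter_upwards [b.eventuallyEq_one_of_mem_ball this] with y hy
    simp [hy]
  · intro x
    rw [lap_comp_smul (fun y => b y ^ (n + 2)), hG, abs_mul, abs_mul, abs_of_nonneg (by positivity),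
      abs_of_nonneg (pow_nonneg b.nonneg n)]
    have h1 : |G (R⁻¹ • x)| ≤ |C| + 1 :=
      ((hC _).trans (le_abs_self C)).trans (by linarith)
    have h2 : 0 ≤ R⁻¹ ^ 2 * b (R⁻¹ • x) ^ n := mul_nonneg (by positivity) (pow_nonneg b.nonneg n)
    nlinarith [mul_le_mul_of_nonneg_left h1 h2]

theorem pow_mul_sq_le_add {y τ t : ℝ} (hy : 0 ≤ y) (hτ : 0 ≤ τ) (ht : 0 < t) (n : ℕ) :
    τ ^ 2 * y ^ n ≤ t ^ 2 * y ^ (n + 2) + t⁻¹ ^ n * τ ^ (n + 2) := by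
  rcases le_total τ (t * y) with h | h
  · have h1 : τ ^ 2 * y ^ n ≤ (t * y) ^ 2 * y ^ n := by gcongr
    have h2 : (t * y) ^ 2 * y ^ n = t ^ 2 * y ^ (n + 2) := by ring
    have h3 : 0 ≤ t⁻¹ ^ n * τ ^ (n + 2) := by positivity
    linarith
  · have h0 : y ≤ t⁻¹ * τ := by rwa [le_inv_mul_iff₀ ht]
    have h1 : τ ^ 2 * y ^ n ≤ τ ^ 2 * (t⁻¹ * τ) ^ n := by gcongr
    have h2 : τ ^ 2 * (t⁻¹ * τ) ^ n = t⁻¹ ^ n * τ ^ (n + 2) := by ring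
    have h3 : 0 ≤ t ^ 2 * y ^ (n + 2) := by positivity
    linarith

/-- Testing `c * z ^ (n + 2) ≤ -Δ (z ^ n)` with a cutoff at scale `R` in dimension `n + 2`. -/
theorem exists_energy_estimate {n : ℕ} {z : EuclideanSpace ℝ (Fin (n + 2)) → ℝ} {c : ℝ}
    (hn : n ≠ 0) (hz : Continuous z) (hz0 : ∀ x, 0 < z x)
    (hv : ContDiff ℝ 2 fun x => z x ^ n)
    (hle : ∀ x, c * z x ^ (n + 2) ≤ -lap (fun x => z x ^ n) x) :
    ∃ A : ℝ, 0 < A ∧ ∀ R : ℝ, 0 < R → ∃ X Y : ℝ,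
      ∫ x in Metric.ball 0 R, z x ^ (n + 2) ≤ X ∧ Y ≤ X ∧
      Y ≤ (∫ x in Metric.ball 0 (2 * R), z x ^ (n + 2)) - ∫ x in Metric.ball 0 R, z x ^ (n + 2) ∧
      ∀ t : ℝ, 0 < t → c * X ≤ A * (t ^ 2 * Y + t⁻¹ ^ n) := by
  obtain ⟨A, hA, hcut⟩ := exists_cutoff (n + 2) n
  set K : ℝ := volume.real (Metric.ball (0 : EuclideanSpace ℝ (Fin (n + 2))) 1)
  have hK : 0 ≤ K := measureReal_nonneg
  refine ⟨A * (1 + 2 ^ (n + 2) * K), by positivity, fun R hR => ?_⟩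
  obtain ⟨η, hη, hηc, hη0, hη1, hη_in, hη_out, hlap_in, hlap⟩ := hcut R hR
  set S : Set (EuclideanSpace ℝ (Fin (n + 2))) := Metric.ball 0 (2 * R) \ Metric.ball 0 R
  have hS : MeasurableSet S := measurableSet_ball.diff measurableSet_ball
  have hφ : ContDiff ℝ 2 fun x => η x ^ (n + 2) := hη.pow _
  have hφc : HasCompactSupport fun x => η x ^ (n + 2) :=
    hηc.comp_left (g := fun s => s ^ (n + 2)) (by simp)
  have hF : Continuous fun x => z x ^ (n + 2) := hz.pow _
  have hFb : ∀ r, IntegrableOn (fun x => z x ^ (n + 2)) (Metric.ball 0 r) := fun r =>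
    (hF.continuousOn.integrableOn_compact (isCompact_closedBall 0 r)).mono_set
      Metric.ball_subset_closedBall
  have hFφ : Integrable fun x => z x ^ (n + 2) * η x ^ (n + 2) :=
    (hF.mul hφ.continuous).integrable_of_hasCompactSupport hφc.mul_left
  have hFφ0 : ∀ x, 0 ≤ z x ^ (n + 2) * η x ^ (n + 2) := fun x =>
    mul_nonneg (pow_nonneg (hz0 x).le _) (pow_nonneg (hη0 x) _)
  refine ⟨∫ x, z x ^ (n + 2) * η x ^ (n + 2), ∫ x in S, z x ^ (n + 2) * η x ^ (n + 2),
    ?_, ?_, ?_, fun t ht => ?_⟩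
  · refine (setIntegral_congr_fun measurableSet_ball fun x hx => ?_).trans_le
      (setIntegral_le_integral hFφ (Eventually.of_forall hFφ0))
    simp [hη_in x hx]
  · exact setIntegral_le_integral hFφ (Eventually.of_forall hFφ0)
  · rw [← setIntegral_sdiff measurableSet_ball (hFb _) (Metric.ball_subset_ball (by linarith))]
    refine setIntegral_mono hFφ.integrableOn ((hFb _).mono_set sdiff_subset) fun x => ?_
    exact mul_le_of_le_one_right (pow_nonneg (hz0 x).le _) (pow_le_one₀ (hη0 x) (hη1 x))
  · have hvol : volume.real S ≤ (2 * R) ^ (n + 2) * K := by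
      have h : volume.real (Metric.ball (0 : EuclideanSpace ℝ (Fin (n + 2))) (2 * R))
          = (2 * R) ^ (n + 2) * K := by
        rw [measureReal_def, Measure.addHaar_ball_of_pos _ _ (by positivity),
          finrank_euclideanSpace_fin, ENNReal.toReal_mul, ENNReal.toReal_ofReal (by positivity),
          ← measureReal_def]
      rw [← h]
      exact measureReal_mono sdiff_subset measure_ball_lt_top.ne
    have hSfin : volume S ≠ ⊤ := (measure_mono sdiff_subset).trans_lt measure_ball_lt_top |>.ne
    have hconst : IntegrableOn (fun _ => t⁻¹ ^ n * R⁻¹ ^ (n + 2)) S :=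
      integrableOn_const hSfin
    have hbound : ∀ x, -((z x ^ n) * lap (fun y => η y ^ (n + 2)) x) ≤
        S.indicator (fun x => A * (t ^ 2 * (z x ^ (n + 2) * η x ^ (n + 2))
          + t⁻¹ ^ n * R⁻¹ ^ (n + 2))) x := by
      intro x
      have hzn : 0 < z x ^ n := pow_pos (hz0 x) n
      by_cases hx : x ∈ S
      · rw [indicator_of_mem hx]
        have h1 := (neg_le_abs _).trans (hlap x)
        have h2 := pow_mul_sq_le_add (mul_nonneg (hz0 x).le (hη0 x)) (inv_nonneg.2 hR.le) ht n
        calc -((z x ^ n) * lap (fun y => η y ^ (n + 2)) x)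
            = z x ^ n * -lap (fun y => η y ^ (n + 2)) x := by ring
          _ ≤ z x ^ n * (A * (R⁻¹ ^ 2 * η x ^ n)) := by gcongr
          _ = A * (R⁻¹ ^ 2 * (z x * η x) ^ n) := by ring
          _ ≤ A * (t ^ 2 * (z x * η x) ^ (n + 2) + t⁻¹ ^ n * R⁻¹ ^ (n + 2)) := by gcongr
          _ = _ := by ring
      · rw [indicator_of_notMem hx]
        have h0 : lap (fun y => η y ^ (n + 2)) x = 0 := by
          by_cases hxR : x ∈ Metric.ball 0 R
          · exact hlap_in x hxR
          · have h1 := hlap x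
            rw [hη_out x fun h => hx ⟨h, hxR⟩, zero_pow hn, mul_zero, mul_zero] at h1
            exact abs_nonpos_iff.1 h1
        simp [h0]
    have hIS : IntegrableOn (fun x => A * (t ^ 2 * (z x ^ (n + 2) * η x ^ (n + 2))
        + t⁻¹ ^ n * R⁻¹ ^ (n + 2))) S :=
      ((hFφ.integrableOn.const_mul _).add hconst).const_mul _
    have hvl : Integrable fun x => (z x ^ n) * lap (fun y => η y ^ (n + 2)) x :=
      (hv.continuous.mul (continuous_lap hφ)).integrable_of_hasCompactSupport hφc.lap.mul_left
    have hlv : Integrable fun x => lap (fun y => z y ^ n) x * η x ^ (n + 2) :=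
      ((continuous_lap hv).mul hφ.continuous).integrable_of_hasCompactSupport hφc.mul_left
    have hY : 0 ≤ ∫ x in S, z x ^ (n + 2) * η x ^ (n + 2) := integral_nonneg hFφ0
    calc c * ∫ x, z x ^ (n + 2) * η x ^ (n + 2)
        = ∫ x, c * (z x ^ (n + 2) * η x ^ (n + 2)) := (integral_const_mul _ _).symm
      _ ≤ ∫ x, -(lap (fun y => z y ^ n) x * η x ^ (n + 2)) := by
          refine integral_mono (hFφ.const_mul _) hlv.neg fun x => ?_
          have := mul_le_mul_of_nonneg_right (hle x) (pow_nonneg (hη0 x) (n + 2))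
          linarith
      _ = ∫ x, -((z x ^ n) * lap (fun y => η y ^ (n + 2)) x) := by
          rw [integral_neg, integral_neg, integral_mul_lap_eq hv hφ hφc]
      _ ≤ ∫ x, S.indicator (fun x => A * (t ^ 2 * (z x ^ (n + 2) * η x ^ (n + 2))
          + t⁻¹ ^ n * R⁻¹ ^ (n + 2))) x :=
          integral_mono hvl.neg ((integrable_indicator_iff hS).2 hIS) hbound
      _ = A * (t ^ 2 * (∫ x in S, z x ^ (n + 2) * η x ^ (n + 2))
          + volume.real S * (t⁻¹ ^ n * R⁻¹ ^ (n + 2))) := by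
          rw [integral_indicator hS, integral_const_mul,
            integral_add (hFφ.integrableOn.const_mul _) hconst, integral_const_mul,
            setIntegral_const, smul_eq_mul]
      _ ≤ A * (t ^ 2 * (∫ x in S, z x ^ (n + 2) * η x ^ (n + 2))
          + (2 * R) ^ (n + 2) * K * (t⁻¹ ^ n * R⁻¹ ^ (n + 2))) := by gcongr
      _ = A * (t ^ 2 * (∫ x in S, z x ^ (n + 2) * η x ^ (n + 2))
          + 2 ^ (n + 2) * K * t⁻¹ ^ n) := by
          have : R ^ (n + 2) * R⁻¹ ^ (n + 2) = 1 := by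
            rw [← mul_pow, mul_inv_cancel₀ hR.ne', one_pow]
          rw [mul_pow]
          linear_combination A * 2 ^ (n + 2) * K * t⁻¹ ^ n * this
      _ ≤ A * (1 + 2 ^ (n + 2) * K) * (t ^ 2 * (∫ x in S, z x ^ (n + 2) * η x ^ (n + 2))
          + t⁻¹ ^ n) := by
          rw [mul_assoc A]
          refine mul_le_mul_of_nonneg_left ?_ hA.le
          have h1 : 0 ≤ 2 ^ (n + 2) * K *
              (t ^ 2 * ∫ x in S, z x ^ (n + 2) * η x ^ (n + 2)) := by positivity
          have h2 : 0 ≤ t⁻¹ ^ n := by positivity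
          linarith

/-- An increasing sequence with positive first term cannot satisfy the critical energy estimates
at all scales. -/
theorem false_of_energy_estimates {n : ℕ} {c A : ℝ} {J : ℕ → ℝ} (hn : n ≠ 0) (hc : 0 < c)
    (hA : 0 < A) (hJ : Monotone J) (hJ0 : 0 < J 0)
    (h : ∀ k, ∃ X Y : ℝ, J k ≤ X ∧ Y ≤ X ∧ Y ≤ J (k + 1) - J k ∧
      ∀ t : ℝ, 0 < t → c * X ≤ A * (t ^ 2 * Y + t⁻¹ ^ n)) : False := by
  have hbdd : ∃ B, ∀ k, J k ≤ B := by
    set t := √(c / (2 * A))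
    have ht : 0 < t := Real.sqrt_pos.2 (by positivity)
    have ht2 : A * t ^ 2 = c / 2 := by
      rw [Real.sq_sqrt (by positivity)]
      field_simp
    refine ⟨2 * (A * t⁻¹ ^ n) / c, fun k => ?_⟩
    obtain ⟨X, Y, hX, hYX, -, hXY⟩ := h k
    rw [le_div_iff₀ hc]
    have h1 := hXY t ht
    have h2 : A * (t ^ 2 * Y + t⁻¹ ^ n) = c / 2 * Y + A * t⁻¹ ^ n := by
      rw [← ht2]
      ring
    nlinarith
  obtain ⟨B, hB⟩ := hbdd
  set t := max 1 (2 * A / (c * J 0))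
  have ht1 : 1 ≤ t := le_max_left _ _
  have ht : 0 < t := by linarith
  have htn : A * t⁻¹ ^ n ≤ c * J 0 / 2 := by
    have h1 : t⁻¹ ^ n ≤ t⁻¹ := pow_le_of_le_one (by positivity) (inv_le_one_of_one_le₀ ht1) hn
    have h2 : 2 * A ≤ t * (c * J 0) := (div_le_iff₀ (by positivity)).1 (le_max_right _ _)
    calc A * t⁻¹ ^ n ≤ A * t⁻¹ := by gcongr
      _ ≤ c * J 0 / 2 := by
        rw [← div_eq_mul_inv, div_le_iff₀ ht]
        linarith
  have hstep : ∀ k, J k + c * J 0 / (2 * A * t ^ 2) ≤ J (k + 1) := by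
    intro k
    obtain ⟨X, Y, hX, -, hY, hXY⟩ := h k
    have h1 := hXY t ht
    have h2 : c * J 0 ≤ c * X := by
      gcongr
      exact (hJ (Nat.zero_le k)).trans hX
    have h3 : c * J 0 / (2 * A * t ^ 2) ≤ Y := by
      rw [div_le_iff₀ (by positivity)]
      linarith
    linarith
  have hlin : ∀ k : ℕ, k * (c * J 0 / (2 * A * t ^ 2)) ≤ J k := by
    intro k
    induction k with
    | zero => simpa using hJ0.le
    | succ k ih =>
      push_cast
      linarith [hstep k]
  have hd : 0 < c * J 0 / (2 * A * t ^ 2) := by positivity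
  obtain ⟨k, hk⟩ := exists_nat_gt (B / (c * J 0 / (2 * A * t ^ 2)))
  rw [div_lt_iff₀ hd] at hk
  linarith [hlin k, hB k]

/-- The Liouville property for `-Δ v ≥ c * v ^ (N / (N - 2))` in dimension `N = n + 2`, written
in terms of `z = v ^ (1 / n)`. -/
theorem false_of_critical_supersolution {n : ℕ} {z : EuclideanSpace ℝ (Fin (n + 2)) → ℝ} {c : ℝ}
    (hn : n ≠ 0) (hc : 0 < c) (hz : Continuous z) (hz0 : ∀ x, 0 < z x)
    (hv : ContDiff ℝ 2 fun x => z x ^ n)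
    (hle : ∀ x, c * z x ^ (n + 2) ≤ -lap (fun x => z x ^ n) x) : False := by
  obtain ⟨A, hA, h⟩ := exists_energy_estimate hn hz hz0 hv hle
  have hFb : ∀ r, IntegrableOn (fun x => z x ^ (n + 2)) (Metric.ball 0 r) := fun r =>
    ((hz.pow _).continuousOn.integrableOn_compact (isCompact_closedBall 0 r)).mono_set
      Metric.ball_subset_closedBall
  have hF0 : ∀ x, 0 < z x ^ (n + 2) := fun x => pow_pos (hz0 x) _
  refine false_of_energy_estimates (J := fun k => ∫ x in Metric.ball 0 (2 ^ k), z x ^ (n + 2))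
    hn hc hA (fun k l hkl => ?_) ?_ fun k => ?_
  · exact setIntegral_mono_set (hFb _) (Eventually.of_forall fun x => (hF0 x).le)
      (Metric.ball_subset_ball (pow_le_pow_right₀ one_le_two hkl)).eventuallyLE
  · rw [setIntegral_pos_iff_support_of_nonneg_ae (Eventually.of_forall fun x => (hF0 x).le) (hFb _)]
    rw [show Function.support (fun x => z x ^ (n + 2)) = univ from
      eq_univ_of_forall fun x => (hF0 x).ne', univ_inter]
    exact Metric.measure_ball_pos _ _ (by positivity)
  · simpa [pow_succ'] using h (2 ^ k) (by positivity)

theorem lap_rpow {N : ℕ} {u : EuclideanSpace ℝ (Fin N) → ℝ} (hu : ContDiff ℝ 2 u)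
    (hu0 : ∀ x, 0 < u x) (a : ℝ) (x : EuclideanSpace ℝ (Fin N)) :
    -lap (fun y => u y ^ a) x
      = a * u x ^ (a - 1) * (-lap u x + (1 - a) * ‖gradient u x‖ ^ 2 / u x) := by
  rw [lap_comp hu (f := fun s => s ^ a) (f' := fun s => a * s ^ (a - 1))
    (f'' := a * ((a - 1) * u x ^ (a - 1 - 1)))]
  · rw [Real.rpow_sub_one (hu0 x).ne' (a - 1)]
    ring
  · exact fun y => Real.hasDerivAt_rpow_const (Or.inl (hu0 y).ne')
  · exact (Real.hasDerivAt_rpow_const (Or.inl (hu0 x).ne')).const_mul a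

theorem liouville_supersolution_whole_space
    {N : ℕ} (hN : 3 ≤ N) {p σ : ℝ} (hp : 1 < p)
    (hσ : σ ≤ ((N : ℝ) - ((N : ℝ) - 2) * p) / 2) :
    ¬ ∃ u : EuclideanSpace ℝ (Fin N) → ℝ,
      ContDiff ℝ 2 u ∧ (∀ x, 0 < u x) ∧
      (∀ x, u x ^ p ≤ -lap u x + σ * ‖gradient u x‖ ^ 2 / u x) := by
  rintro ⟨u, hu, hu0, hle⟩
  obtain ⟨n, rfl⟩ : ∃ n, N = n + 2 := ⟨N - 2, by omega⟩
  have hn : n ≠ 0 := by omega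
  have hn' : (0 : ℝ) < n := by exact_mod_cast Nat.pos_of_ne_zero hn
  push_cast at hσ
  set a : ℝ := (p - 1) / 2 * n with ha
  have ha0 : 0 < a := mul_pos (by linarith) hn'
  have hpow : (fun x => (u x ^ ((p - 1) / 2)) ^ n) = fun x => u x ^ a := by
    funext x
    rw [ha, Real.rpow_mul (hu0 x).le, Real.rpow_natCast]
  refine false_of_critical_supersolution (z := fun x => u x ^ ((p - 1) / 2)) hn ha0
    (hu.continuous.rpow_const fun x => Or.inl (hu0 x).ne') (fun x => Real.rpow_pos_of_pos (hu0 x) _)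
    ?_ fun x => ?_
  · rw [hpow]
    exact hu.rpow_const_of_ne fun x => (hu0 x).ne'
  · rw [hpow, lap_rpow hu hu0]
    have h1 : (u x ^ ((p - 1) / 2)) ^ (n + 2) = u x ^ (a - 1) * u x ^ p := by
      rw [← Real.rpow_natCast, ← Real.rpow_mul (hu0 x).le, ← Real.rpow_add (hu0 x)]
      congr 1
      push_cast
      rw [ha]
      ring
    have h2 : σ * ‖gradient u x‖ ^ 2 / u x ≤ (1 - a) * ‖gradient u x‖ ^ 2 / u x := by
      have := (hu0 x).le
      gcongr
      rw [ha]
      linarith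
    have h3 : 0 < u x ^ (a - 1) := Real.rpow_pos_of_pos (hu0 x) _
    rw [h1, ← mul_assoc]
    gcongr
    linarith [hle x]
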